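/- The subspace M is a two-sided ideal of the algebra A_n^{t_n}(d) (i.e. for all x ∈ A_n^{t_n}(d) and m ∈ M, both xm and mx lie in M), and A_n^{t_n}(d) = M + span_ℂ{V(σ) : σ ∈ S(n), σ(n) = n}. Moreover, if n ≥ 2 and d ≥ 2, then for every σ ∈ S(n) with σ(n) ≠ n the matrix V(σ)^{t_n} is not invertible. -/

import Mathlib

/-- The permutation operator `V(σ)` on `(ℂ^d)^{⊗ n}`, realized as the square matrix
indexed by functions `f g : Fin n → Fin d`, with entry `1` if `g = f ∘ σ` and `0` otherwise. -/
noncomputable def V (n d : ℕ) (σ : Equiv.Perm (Fin n)) :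
    Matrix (Fin n → Fin d) (Fin n → Fin d) ℂ :=
  Matrix.of fun f g => if g = f ∘ σ then 1 else 0

/-- Partial transpose of a matrix on `(ℂ^d)^{⊗ n}` at position `p`. -/
noncomputable def pt {n d : ℕ} (p : Fin n)
    (A : Matrix (Fin n → Fin d) (Fin n → Fin d) ℂ) :
    Matrix (Fin n → Fin d) (Fin n → Fin d) ℂ :=
  Matrix.of fun f g =>
    A (Function.update f p (g p)) (Function.update g p (f p))

/-- The last position `n` of the tensor product, as an element of `Fin n`. -/
def lastIdx (n : ℕ) (hn : 1 ≤ n) : Fin n := ⟨n - 1, by omega⟩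

/-- The algebra `A_n^{t_n}(d)`: the `ℂ`-linear span of `{V(σ)^{t_n} : σ ∈ S(n)}`. -/
noncomputable def Aspan (n d : ℕ) (hn : 1 ≤ n) :
    Submodule ℂ (Matrix (Fin n → Fin d) (Fin n → Fin d) ℂ) :=
  Submodule.span ℂ (Set.range fun σ : Equiv.Perm (Fin n) => pt (lastIdx n hn) (V n d σ))

/-- The ideal `M`: the `ℂ`-linear span of `{V(σ)^{t_n} : σ ∈ S(n), σ(n) ≠ n}`. -/
noncomputable def Mid (n d : ℕ) (hn : 1 ≤ n) :
    Submodule ℂ (Matrix (Fin n → Fin d) (Fin n → Fin d) ℂ) :=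
  Submodule.span ℂ
    {x | ∃ σ : Equiv.Perm (Fin n), σ (lastIdx n hn) ≠ lastIdx n hn ∧
      x = pt (lastIdx n hn) (V n d σ)}

theorem V_mul_apply {n d : ℕ} (σ : Equiv.Perm (Fin n))
    (A : Matrix (Fin n → Fin d) (Fin n → Fin d) ℂ) (f g : Fin n → Fin d) :
    (V n d σ * A) f g = A (f ∘ σ) g := by
  simp [Matrix.mul_apply, V]

theorem mul_V_apply {n d : ℕ} (σ : Equiv.Perm (Fin n))
    (A : Matrix (Fin n → Fin d) (Fin n → Fin d) ℂ) (f g : Fin n → Fin d) :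
    (A * V n d σ) f g = A f (g ∘ σ.symm) := by
  have h (x : Fin n → Fin d) : g = x ∘ σ ↔ x = g ∘ σ.symm := by
    rw [Equiv.eq_comp_symm, eq_comm]
  simp [Matrix.mul_apply, V, h]

theorem V_mul_V {n d : ℕ} (σ τ : Equiv.Perm (Fin n)) :
    V n d σ * V n d τ = V n d (σ * τ) := by
  ext f g
  rw [V_mul_apply]
  rfl

theorem update_comp_perm_of_fixed {n d : ℕ} {p : Fin n} {σ : Equiv.Perm (Fin n)}
    (hσ : σ p = p) (f : Fin n → Fin d) (x : Fin d) :
    Function.update (f ∘ σ) p x = Function.update f p x ∘ σ := by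
  rw [Function.update_comp_equiv, (Equiv.symm_apply_eq σ).mpr hσ.symm]

theorem V_mul_pt {n d : ℕ} {p : Fin n} {σ : Equiv.Perm (Fin n)} (hσ : σ p = p)
    (A : Matrix (Fin n → Fin d) (Fin n → Fin d) ℂ) :
    V n d σ * pt p A = pt p (V n d σ * A) := by
  ext f g
  simp [V_mul_apply, pt, update_comp_perm_of_fixed hσ, hσ]

theorem pt_mul_V {n d : ℕ} {p : Fin n} {σ : Equiv.Perm (Fin n)} (hσ : σ p = p)
    (A : Matrix (Fin n → Fin d) (Fin n → Fin d) ℂ) :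
    pt p A * V n d σ = pt p (A * V n d σ) := by
  have hσ' : σ.symm p = p := (Equiv.symm_apply_eq σ).mpr hσ.symm
  ext f g
  simp [mul_V_apply, pt, update_comp_perm_of_fixed hσ', hσ']

theorem pt_V_of_fixed {n d : ℕ} {p : Fin n} {σ : Equiv.Perm (Fin n)} (hσ : σ p = p) :
    pt p (V n d σ) = V n d σ := by
  ext f g
  simp only [pt, V, Matrix.of_apply]
  congr 1
  simp only [← update_comp_perm_of_fixed hσ, eq_iff_iff]
  constructor
  · intro h
    ext i
    have hi := congrFun h i
    rcases eq_or_ne i p with rfl | hip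
    · simp at hi
      simp [hσ, hi]
    · simpa [hip] using congrArg Fin.val hi
  · rintro rfl
    simp [hσ]

theorem pt_V_apply_eq_zero {n d : ℕ} {p : Fin n} {σ : Equiv.Perm (Fin n)} (hσ : σ p ≠ p)
    {f : Fin n → Fin d} (hf : f p ≠ f (σ p)) (g : Fin n → Fin d) :
    pt p (V n d σ) f g = 0 := by
  simp only [pt, V, Matrix.of_apply, ite_eq_right_iff]
  intro h
  have hp := congrFun h p
  simp [hσ] at hp
  exact absurd hp hf

theorem pt_V_swap_apply {n d : ℕ} {p a : Fin n} (ha : a ≠ p) (f g : Fin n → Fin d) :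
    pt p (V n d (Equiv.swap p a)) f g =
      if f p = f a ∧ g p = g a ∧ ∀ i, i ≠ p → i ≠ a → g i = f i then 1 else 0 := by
  simp only [pt, V, Matrix.of_apply]
  congr 1
  rw [eq_iff_iff, funext_iff]
  constructor
  · intro h
    refine ⟨by simpa [ha] using h p, by simpa [ha] using (h a).symm, fun i hp hi => ?_⟩
    simpa [hp, hi, Equiv.swap_apply_of_ne_of_ne] using h i
  · rintro ⟨h1, h2, h3⟩ i
    rcases eq_or_ne i p with rfl | hp
    · simpa [ha] using h1
    rcases eq_or_ne i a with rfl | hi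
    · simpa [ha] using h2.symm
    · simpa [hp, hi, Equiv.swap_apply_of_ne_of_ne] using h3 i hp hi

theorem pt_V_swap_mul_self {n d : ℕ} {p a : Fin n} (ha : a ≠ p) :
    pt p (V n d (Equiv.swap p a)) * pt p (V n d (Equiv.swap p a)) =
      (d : ℂ) • pt p (V n d (Equiv.swap p a)) := by
  ext f g
  simp only [Matrix.mul_apply, Matrix.smul_apply, pt_V_swap_apply ha, smul_eq_mul, mul_ite,
    mul_one, mul_zero, ← ite_and]
  split_ifs with hfg
  · obtain ⟨h1, h2, h3⟩ := hfg
    rw [Finset.sum_boole, Nat.cast_inj]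
    conv_rhs => rw [← Fintype.card_fin d, ← Finset.card_univ]
    refine Finset.card_nbij' (fun h => h p)
      (fun x => Function.update (Function.update f p x) a x) ?_ ?_ ?_ ?_
    · intro h _
      simp
    · intro x _
      simp [ha.symm, h1, h2]
      grind
    · intro h hh
      simp only [Finset.coe_filter, Finset.mem_univ, true_and, Set.mem_ofPred_eq] at hh
      ext i
      grind
    · intro x _
      simp [ha.symm]
  · refine Finset.sum_eq_zero fun h _ => if_neg fun hh => hfg ?_
    grind

theorem pt_V_swap_mul_pt_V_swap {n d : ℕ} {p a b : Fin n} (ha : a ≠ p) (hb : b ≠ p)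
    (hab : a ≠ b) :
    pt p (V n d (Equiv.swap p a)) * pt p (V n d (Equiv.swap p b)) =
      pt p (V n d (Equiv.swap p a)) * V n d (Equiv.swap a b) := by
  ext f g
  rw [mul_V_apply]
  simp only [Matrix.mul_apply, pt_V_swap_apply ha, pt_V_swap_apply hb, mul_ite,
    mul_one, mul_zero, ← ite_and]
  rw [Finset.sum_eq_single (Function.update (Function.update f p (f b)) a (f b))]
  · congr 1
    simp only [Function.comp_apply, Equiv.symm_swap, Equiv.swap_apply_def]
    grind
  · intro h _ hne
    refine if_neg fun hh => hne ?_
    ext i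
    grind
  · simp

theorem exists_pt_V_mul_pt_V {n d : ℕ} {p : Fin n} {σ τ : Equiv.Perm (Fin n)}
    (hσ : σ p ≠ p) (hτ : τ p ≠ p) :
    ∃ (c : ℂ) (ρ : Equiv.Perm (Fin n)), ρ p ≠ p ∧
      pt p (V n d σ) * pt p (V n d τ) = c • pt p (V n d ρ) := by
  obtain ⟨a, ha⟩ : ∃ a, a = σ p := ⟨_, rfl⟩
  obtain ⟨e, he⟩ : ∃ e, e = τ.symm p := ⟨_, rfl⟩
  have hap : a ≠ p := ha ▸ hσ
  have hep : e ≠ p := by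
    rintro rfl
    exact hτ ((Equiv.eq_symm_apply τ).mp he)
  have hα : (Equiv.swap p a * σ) p = p := by simp [← ha]
  have hβ : (τ * Equiv.swap p e) p = p := by simp [he]
  obtain ⟨γ, hγ⟩ : ∃ γ, γ = (Equiv.swap p a * σ) * (τ * Equiv.swap p e) := ⟨_, rfl⟩
  have hγp : γ p = p := by rw [hγ, Equiv.Perm.mul_apply, hβ, hα]
  have hγe : γ e ≠ p := fun h => hep (γ.injective (h.trans hγp.symm))
  have hσ' : pt p (V n d σ) =
      pt p (V n d (Equiv.swap p a)) * V n d (Equiv.swap p a * σ) := by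
    rw [pt_mul_V hα, V_mul_V, Equiv.swap_mul_self_mul]
  have hτ' : pt p (V n d τ) =
      V n d (τ * Equiv.swap p e) * pt p (V n d (Equiv.swap p e)) := by
    rw [V_mul_pt hβ, V_mul_V, Equiv.mul_swap_mul_self]
  have key : pt p (V n d σ) * pt p (V n d τ) =
      pt p (V n d (Equiv.swap p a)) * pt p (V n d (Equiv.swap p (γ e))) * V n d γ := by
    rw [hσ', hτ', mul_assoc, ← mul_assoc (V n d _) (V n d _), V_mul_V, ← hγ, V_mul_pt hγp,
      V_mul_V, Equiv.mul_swap_eq_swap_mul, hγp, ← V_mul_V, ← pt_mul_V hγp, ← mul_assoc]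
  rcases eq_or_ne a (γ e) with hae | hae
  · refine ⟨d, Equiv.swap p a * γ, by simpa [hγp] using hap, ?_⟩
    rw [key, ← hae, pt_V_swap_mul_self hap, smul_mul_assoc, pt_mul_V hγp, V_mul_V]
  · have hs : Equiv.swap a (γ e) p = p := Equiv.swap_apply_of_ne_of_ne hap.symm hγe.symm
    refine ⟨1, Equiv.swap p a * Equiv.swap a (γ e) * γ, by simpa [hγp, hs] using hap, ?_⟩
    rw [key, pt_V_swap_mul_pt_V_swap hap hγe hae, pt_mul_V hs, V_mul_V, pt_mul_V hγp, V_mul_V,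
      one_smul]

theorem pt_V_mem_Mid {n d : ℕ} {hn : 1 ≤ n} {σ : Equiv.Perm (Fin n)}
    (hσ : σ (lastIdx n hn) ≠ lastIdx n hn) :
    pt (lastIdx n hn) (V n d σ) ∈ Mid n d hn :=
  Submodule.subset_span ⟨σ, hσ, rfl⟩

theorem pt_V_mul_pt_V_mem_Mid {n d : ℕ} {hn : 1 ≤ n} {σ τ : Equiv.Perm (Fin n)}
    (h : σ (lastIdx n hn) ≠ lastIdx n hn ∨ τ (lastIdx n hn) ≠ lastIdx n hn) :
    pt (lastIdx n hn) (V n d σ) * pt (lastIdx n hn) (V n d τ) ∈ Mid n d hn := by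
  by_cases hσ : σ (lastIdx n hn) = lastIdx n hn
  · rw [pt_V_of_fixed hσ, V_mul_pt hσ, V_mul_V]
    refine pt_V_mem_Mid fun hp => h.resolve_left (not_not.mpr hσ) ?_
    exact σ.injective (hp.trans hσ.symm)
  by_cases hτ : τ (lastIdx n hn) = lastIdx n hn
  · rw [pt_V_of_fixed hτ, pt_mul_V hτ, V_mul_V]
    exact pt_V_mem_Mid (by simpa [hτ] using hσ)
  · obtain ⟨c, ρ, hρ, hmul⟩ := exists_pt_V_mul_pt_V (d := d) hσ hτ
    rw [hmul]
    exact Submodule.smul_mem _ c (pt_V_mem_Mid hρ)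

theorem Aspan_mul_Mid_le {n d : ℕ} (hn : 1 ≤ n) :
    Aspan n d hn * Mid n d hn ≤ Mid n d hn := by
  conv_lhs => rw [Aspan, Mid, Submodule.span_mul_span]
  rw [Submodule.span_le]
  rintro _ ⟨_, ⟨σ, rfl⟩, _, ⟨τ, hτ, rfl⟩, rfl⟩
  exact pt_V_mul_pt_V_mem_Mid (Or.inr hτ)

theorem Mid_mul_Aspan_le {n d : ℕ} (hn : 1 ≤ n) :
    Mid n d hn * Aspan n d hn ≤ Mid n d hn := by
  conv_lhs => rw [Aspan, Mid, Submodule.span_mul_span]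
  rw [Submodule.span_le]
  rintro _ ⟨_, ⟨σ, hσ, rfl⟩, _, ⟨τ, rfl⟩, rfl⟩
  exact pt_V_mul_pt_V_mem_Mid (Or.inl hσ)

theorem Aspan_eq_Mid_sup {n d : ℕ} (hn : 1 ≤ n) :
    Aspan n d hn = Mid n d hn ⊔
      Submodule.span ℂ
        {x | ∃ σ : Equiv.Perm (Fin n), σ (lastIdx n hn) = lastIdx n hn ∧ x = V n d σ} := by
  rw [Aspan, Mid, ← Submodule.span_union]
  congr 1
  ext x
  constructor
  · rintro ⟨σ, rfl⟩
    by_cases hσ : σ (lastIdx n hn) = lastIdx n hn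
    · exact Or.inr ⟨σ, hσ, pt_V_of_fixed hσ⟩
    · exact Or.inl ⟨σ, hσ, rfl⟩
  · rintro (⟨σ, -, rfl⟩ | ⟨σ, hσ, rfl⟩)
    · exact ⟨σ, rfl⟩
    · exact ⟨σ, pt_V_of_fixed hσ⟩

theorem not_isUnit_pt_V {n d : ℕ} (hd : 2 ≤ d) {p : Fin n} {σ : Equiv.Perm (Fin n)}
    (hσ : σ p ≠ p) : ¬ IsUnit (pt p (V n d σ)) := by
  have : Nontrivial (Fin d) := Fin.nontrivial_iff_two_le.mpr hd
  obtain ⟨x, y, hxy⟩ := exists_pair_ne (Fin d)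
  rw [Matrix.isUnit_iff_isUnit_det, Matrix.det_eq_zero_of_row_eq_zero
    (Function.update (fun _ => x) p y) (pt_V_apply_eq_zero hσ (by simpa [hσ] using hxy.symm))]
  exact not_isUnit_zero

/-- `M` is a two-sided ideal of `A_n^{t_n}(d)`; the algebra decomposes as
`A_n^{t_n}(d) = M + span{V(σ) : σ(n) = n}`; and for `n ≥ 2`, `d ≥ 2` the generators
`V(σ)^{t_n}` with `σ(n) ≠ n` are not invertible. -/
theorem M_is_ideal (n d : ℕ) (hn : 1 ≤ n) (hd : 1 ≤ d) :
    (∀ x ∈ Aspan n d hn, ∀ m ∈ Mid n d hn, x * m ∈ Mid n d hn ∧ m * x ∈ Mid n d hn) ∧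
    Aspan n d hn = Mid n d hn ⊔
      Submodule.span ℂ
        {x | ∃ σ : Equiv.Perm (Fin n), σ (lastIdx n hn) = lastIdx n hn ∧ x = V n d σ} ∧
    (2 ≤ n → 2 ≤ d → ∀ σ : Equiv.Perm (Fin n), σ (lastIdx n hn) ≠ lastIdx n hn →
      ¬ IsUnit (pt (lastIdx n hn) (V n d σ))) := by
  exact ⟨fun x hx m hm => ⟨Aspan_mul_Mid_le hn (Submodule.mul_mem_mul hx hm),
    Mid_mul_Aspan_le hn (Submodule.mul_mem_mul hm hx)⟩,
    Aspan_eq_Mid_sup hn, fun _ hd2 _ hσ => not_isUnit_pt_V hd2 hσ⟩
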